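/- Let M be a module over ZMod 2 and let m ≥ 2 be a natural number. Let b₁, b_m ∈ ZMod 2, let Δ : {1,…,m} → M, and suppose we are given elements r_{j,1}⁰, r_{j,1}¹ ∈ M for j = 2,…,m, elements r_{j,m}⁰, r_{j,m}¹ ∈ M for j = 1,…,m−1, and outputs r₁,…,r_m ∈ M satisfying: (i) r₁ = ∑_{j=2}^{m} ( [r_{j,1}⁰ + b₁ • (r_{j,1}⁰ + r_{j,1}¹)] + b₁ • (Δ_j + r_{j,1}⁰ + r_{j,1}¹) ) + r_{1,m}⁰ + b₁ • Δ₁; (ii) r_i = r_{i,1}⁰ + r_{i,m}⁰ for every 1 < i < m; and (iii) r_m = ∑_{j=1}^{m−1} ( [r_{j,m}⁰ + b_m • (r_{j,m}⁰ + r_{j,m}¹)] + b_m • (Δ_j + r_{j,m}⁰ + r_{j,m}¹) ) + r_{m,1}⁰ + b_m • Δ_m. Then ∑_{i=1}^{m} r_i = (b₁ + b_m) • ∑_{i=1}^{m} Δ_i. In particular, if b₁ + b_m = 0 then the outputs sum to 0, and otherwise they sum to ∑_{i=1}^{m} Δ_i. -/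

import Mathlib

theorem add_self_eq_zero_of_zmod_two {M : Type*} [AddCommGroup M] [Module (ZMod 2) M] (x : M) :
    x + x = 0 := by
  rw [← two_smul (ZMod 2) x, show (2 : ZMod 2) = 0 from rfl, zero_smul]

/-- The received string plus the masked derandomization message is the sender's zero string
masked by `b • d`. -/
theorem derandomize_eq {M : Type*} [AddCommGroup M] [Module (ZMod 2) M] (b : ZMod 2)
    (x y d : M) : (x + b • (x + y)) + b • (d + x + y) = x + b • d := by
  have h := add_self_eq_zero_of_zmod_two (b • (x + y))
  calc (x + b • (x + y)) + b • (d + x + y)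
      = x + b • d + (b • (x + y) + b • (x + y)) := by module
    _ = x + b • d := by rw [h, add_zero]

theorem sum_Icc_one_eq_add_sum_Ioo_add {M : Type*} [AddCommMonoid M] {m : ℕ} (hm : 2 ≤ m)
    (f : ℕ → M) :
    ∑ i ∈ Finset.Icc 1 m, f i = f 1 + (∑ i ∈ Finset.Ioo 1 m, f i + f m) := by
  rw [← Finset.add_sum_Ioc_eq_sum_Icc (by lia), Finset.sum_Ioo_add_eq_sum_Ioc (by lia)]

/-- Correctness of the multi-party secret-shared random OT protocol:
with the protocol equations (i)–(iii) as hypotheses, the parties' outputs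
XOR to `(b₁ + b_m) • ∑ Δ_i`; in particular they XOR to `0` when the shared
choice bit `b₁ + b_m` is `0`, and to `∑ Δ_i` otherwise. -/
theorem stmt_0 (M : Type*) [AddCommGroup M] [Module (ZMod 2) M]
    (m : ℕ) (hm : 2 ≤ m)
    (b1 bm : ZMod 2)
    (Δ : ℕ → M)
    (rj1_0 rj1_1 : ℕ → M)  -- r_{j,1}⁰, r_{j,1}¹ for j = 2,…,m
    (rjm_0 rjm_1 : ℕ → M)  -- r_{j,m}⁰, r_{j,m}¹ for j = 1,…,m−1
    (r : ℕ → M)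
    (h1 : r 1 = (∑ j ∈ Finset.Icc 2 m,
        ((rj1_0 j + b1 • (rj1_0 j + rj1_1 j)) + b1 • (Δ j + rj1_0 j + rj1_1 j)))
        + rjm_0 1 + b1 • Δ 1)
    (h2 : ∀ i, 1 < i → i < m → r i = rj1_0 i + rjm_0 i)
    (h3 : r m = (∑ j ∈ Finset.Icc 1 (m - 1),
        ((rjm_0 j + bm • (rjm_0 j + rjm_1 j)) + bm • (Δ j + rjm_0 j + rjm_1 j)))
        + rj1_0 m + bm • Δ m) :
    (∑ i ∈ Finset.Icc 1 m, r i) = (b1 + bm) • ∑ i ∈ Finset.Icc 1 m, Δ i ∧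
    (b1 + bm = 0 → (∑ i ∈ Finset.Icc 1 m, r i) = 0) ∧
    (b1 + bm ≠ 0 → (∑ i ∈ Finset.Icc 1 m, r i) = ∑ i ∈ Finset.Icc 1 m, Δ i) := by
  have key : (∑ i ∈ Finset.Icc 1 m, r i) = (b1 + bm) • ∑ i ∈ Finset.Icc 1 m, Δ i := by
    have e2 : Finset.Icc 2 m = Finset.Ioc 1 m := by ext; simp; lia
    have e3 : Finset.Icc 1 (m - 1) = Finset.Ico 1 m := by ext; simp; lia
    have hmid : ∑ i ∈ Finset.Ioo 1 m, r i =
        ∑ i ∈ Finset.Ioo 1 m, rj1_0 i + ∑ i ∈ Finset.Ioo 1 m, rjm_0 i := by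
      rw [← Finset.sum_add_distrib]
      exact Finset.sum_congr rfl fun i hi =>
        h2 i (Finset.mem_Ioo.1 hi).1 (Finset.mem_Ioo.1 hi).2
    simp only [derandomize_eq] at h1 h3
    rw [e2, ← Finset.sum_Ioo_add_eq_sum_Ioc (by lia), Finset.sum_add_distrib,
      ← Finset.smul_sum] at h1
    rw [e3, ← Finset.add_sum_Ioo_eq_sum_Ico (by lia), Finset.sum_add_distrib,
      ← Finset.smul_sum] at h3
    rw [sum_Icc_one_eq_add_sum_Ioo_add hm, sum_Icc_one_eq_add_sum_Ioo_add hm, hmid, h1, h3]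
    have h := add_self_eq_zero_of_zmod_two
      (∑ i ∈ Finset.Ioo 1 m, rj1_0 i + ∑ i ∈ Finset.Ioo 1 m, rjm_0 i + rj1_0 m + rjm_0 1)
    rw [← sub_eq_zero, ← h]
    module
  refine ⟨key, fun h => by rw [key, h, zero_smul], fun h => ?_⟩
  have hb : b1 + bm = 1 := Fin.eq_one_of_ne_zero _ h
  rw [key, hb, one_smul]
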